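/- arXiv:1709.10157 — 2 statements merged into one kernel-verified Lean document; each statement's English description precedes it below -/
import Mathlib

section
/- Suppose W is an m×m real symmetric matrix with nonnegative entries and positive diagonal entries whose Laplacian L = D − W has kernel exactly the span of the all-ones vector 1_m (connected graph), c ≥ 0, c̄ > 0, and κ_i = 1/d_i where d_i = D_ii for each i. Let x, z : ℕ → ℝ^{mn} be any sequences satisfying, for all t, the implicit update equations x(t+1) = x(t) − c̄K̄(Ā'Ā x(t+1) − Ā'b) − K̄(D̄ z(t+1) − W̄ z(t)) − cK̄(D̄ x(t+1) − W̄ x(t)) and z(t+1) = z(t) + K̄(D̄ x(t+1) − W̄ x(t)). Then there exist a vector x* ∈ ℝ^n minimizing y ↦ (1/2)Σ_{i=1}^m ‖A_i y − b_i‖² over ℝ^n, and constants C ≥ 0 and r ∈ [0,1), such that ‖x(t) − 1_m ⊗ x*‖ ≤ C·r^t for all t. -/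
open Matrix
open scoped Kronecker

noncomputable section

/-- `M̄ = M ⊗ I_n`. -/
def bar (n : ℕ) {m : ℕ} (M : Matrix (Fin m) (Fin m) ℝ) :
    Matrix (Fin m × Fin n) (Fin m × Fin n) ℝ :=
  M ⊗ₖ (1 : Matrix (Fin n) (Fin n) ℝ)

/-- `D`: the diagonal matrix of row sums of `W`. -/
def rowSumDiag {m : ℕ} (W : Matrix (Fin m) (Fin m) ℝ) : Matrix (Fin m) (Fin m) ℝ :=
  Matrix.diagonal fun i => ∑ j, W i j

/-- `Ā = blockdiag(A_1, …, A_m)`. -/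
def blockDiag {m n : ℕ} (ni : Fin m → ℕ) (A : ∀ i, Matrix (Fin (ni i)) (Fin n) ℝ) :
    Matrix ((i : Fin m) × Fin (ni i)) (Fin m × Fin n) ℝ :=
  fun p q => if p.1 = q.1 then A p.1 p.2 q.2 else 0

/-- `b = col(b_1, …, b_m)`. -/
def bvec {m : ℕ} {ni : Fin m → ℕ} (b : ∀ i, Fin (ni i) → ℝ) :
    (i : Fin m) × Fin (ni i) → ℝ := fun p => b p.1 p.2

open scoped InnerProductSpace

theorem norm_lt_one_of_real_quadratic {N S Q : ℝ} {μ : ℂ} (hQ : |Q| < N) (h1 : 0 < N - S + Q)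
    (h2 : 0 < N + S + Q) (hμ : (N : ℂ) * μ ^ 2 - S * μ + Q = 0) : ‖μ‖ < 1 := by
  obtain ⟨x, y⟩ := μ
  obtain ⟨hQ1, hQ2⟩ := abs_lt.mp hQ
  have hN : 0 < N := (abs_nonneg Q).trans_lt hQ
  have hre := congrArg Complex.re hμ
  have him := congrArg Complex.im hμ
  simp [pow_two] at hre him
  have hlt : x * x + y * y < 1 := by
    rcases eq_or_ne y 0 with rfl | hy
    · have hx1 : x < 1 := by
        by_contra! h
        nlinarith [mul_nonneg (sub_nonneg.2 h) (by nlinarith : 0 ≤ N * x - Q)]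
      have hx2 : -1 < x := by
        by_contra! h
        nlinarith [mul_nonneg (by linarith : 0 ≤ -1 - x) (by nlinarith : 0 ≤ -N * x - Q)]
      nlinarith
    · have hS : S = 2 * N * x := by
        have : y * (2 * N * x - S) = 0 := by linarith
        linarith [(mul_eq_zero.1 this).resolve_left hy]
      subst hS
      by_contra! h
      nlinarith
  rw [← sq_lt_one_iff₀ (norm_nonneg _), Complex.sq_norm, Complex.normSq_mk]
  exact hlt

theorem exists_norm_pow_le_of_spectralRadius_lt_one {A : Type*} [NormedRing A]
    [NormedAlgebra ℂ A] [CompleteSpace A] (a : A) (ha : spectralRadius ℂ a < 1) :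
    ∃ C r : ℝ, 0 ≤ C ∧ 0 ≤ r ∧ r < 1 ∧ ∀ t : ℕ, ‖a ^ t‖ ≤ C * r ^ t := by
  obtain ⟨r, hr1, hr2⟩ := ENNReal.lt_iff_exists_nnreal_btwn.1 ha
  have hr : r < 1 := by exact_mod_cast hr2
  have hr0 : 0 < r := by
    have := (zero_le : 0 ≤ spectralRadius ℂ a).trans_lt hr1
    exact_mod_cast this
  have hev :=
    (spectrum.pow_nnnorm_pow_one_div_tendsto_nhds_spectralRadius a).eventually_lt_const hr1
  obtain ⟨T, hT⟩ := Filter.eventually_atTop.1 hev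
  refine ⟨1 + ∑ k ∈ Finset.range (T + 1), ‖a ^ k‖ / r ^ k, r, by positivity, r.2, hr, fun t => ?_⟩
  have hrt : (0 : ℝ) < r ^ t := by positivity
  rw [← div_le_iff₀ hrt]
  rcases lt_or_ge t (T + 1) with h | h
  · have := Finset.single_le_sum (f := fun k => ‖a ^ k‖ / (r : ℝ) ^ k) (fun k _ => by positivity)
      (Finset.mem_range.2 h)
    linarith
  · have ht : t ≠ 0 := by omega
    have h1 := (hT t (by omega)).le
    rw [one_div, ENNReal.rpow_inv_le_iff (by positivity), ENNReal.rpow_natCast] at h1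
    have h2 : ‖a ^ t‖ ≤ (r : ℝ) ^ t := by exact_mod_cast h1
    have h3 : ‖a ^ t‖ / (r : ℝ) ^ t ≤ 1 := (div_le_one hrt).2 h2
    have : 0 ≤ ∑ k ∈ Finset.range (T + 1), ‖a ^ k‖ / (r : ℝ) ^ k := by positivity
    linarith

theorem Module.End.exists_norm_pow_apply_le {V : Type*} [NormedAddCommGroup V] [NormedSpace ℂ V]
    [FiniteDimensional ℂ V] (T : Module.End ℂ V) (hT : ∀ μ, T.HasEigenvalue μ → ‖μ‖ < 1) :
    ∃ C r : ℝ, 0 ≤ C ∧ 0 ≤ r ∧ r < 1 ∧ ∀ (v : V) (t : ℕ), ‖(T ^ t) v‖ ≤ C * r ^ t * ‖v‖ := by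
  have : CompleteSpace V := FiniteDimensional.complete ℂ V
  rcases subsingleton_or_nontrivial V with hV | hV
  · exact ⟨0, 0, le_rfl, le_rfl, one_pos, fun v t => by simp [Subsingleton.elim _ (0 : V)]⟩
  let a : V →L[ℂ] V := Module.End.toContinuousLinearMap V T
  have hσ : ∀ μ ∈ spectrum ℂ a, ‖μ‖₊ < 1 := fun μ hμ => by
    rw [AlgEquiv.spectrum_eq] at hμ
    exact hT μ (Module.End.hasEigenvalue_iff_mem_spectrum.2 hμ)
  obtain ⟨C, r, hC, hr0, hr1, h⟩ := exists_norm_pow_le_of_spectralRadius_lt_one a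
    (by simpa using spectrum.spectralRadius_lt_of_forall_lt a hσ)
  refine ⟨C, r, hC, hr0, hr1, fun v t => ?_⟩
  have hv : (T ^ t) v = (a ^ t) v := by
    rw [← map_pow]; rfl
  rw [hv]
  exact ((a ^ t).le_opNorm v).trans (by gcongr; exact h t)

theorem Module.End.exists_norm_pow_apply_sub_le {V : Type*} [NormedAddCommGroup V]
    [NormedSpace ℂ V] [FiniteDimensional ℂ V] (T : Module.End ℂ V)
    (hT : ∀ μ, T.HasEigenvalue μ → μ = 1 ∨ ‖μ‖ < 1)
    (h1 : ∀ u v, T v = v → T u = u + v → v = 0) (u : V) :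
    ∃ v, T v = v ∧ ∃ C r : ℝ, 0 ≤ C ∧ 0 ≤ r ∧ r < 1 ∧
      ∀ t : ℕ, ‖(T ^ t) u - v‖ ≤ C * r ^ t := by
  set R := LinearMap.range (T - 1)
  set K := LinearMap.ker (T - 1)
  have hdisj : Disjoint K R := by
    rw [Submodule.disjoint_def]
    rintro v hv ⟨w, rfl⟩
    refine h1 w _ ?_ ?_
    · simpa [K, sub_eq_zero] using hv
    · simp
  have hcompl : IsCompl K R :=
    (Submodule.isCompl_iff_disjoint K R (by
      rw [add_comm]; exact (LinearMap.finrank_range_add_finrank_ker (T - 1)).ge)).2 hdisj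
  have hmaps : ∀ v ∈ R, T v ∈ R := by
    rintro _ ⟨w, rfl⟩
    exact ⟨T w, by simp⟩
  obtain ⟨C, r, hC, hr0, hr1, hbound⟩ :=
    Module.End.exists_norm_pow_apply_le (T.restrict hmaps) fun μ hμ => by
      obtain ⟨⟨v, hvR⟩, hv⟩ := hμ.exists_hasEigenvector
      have hv0 : v ≠ 0 := fun h => hv.2 (by simp [h])
      have hTv : T v = μ • v := congrArg Subtype.val hv.apply_eq_smul
      refine (hT μ (Module.End.hasEigenvalue_of_hasEigenvector
        ⟨Module.End.mem_eigenspace_iff.2 hTv, hv0⟩)).resolve_left ?_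
      rintro rfl
      exact hv0 ((Submodule.disjoint_def.1 hdisj) v (by simp [K, hTv]) hvR)
  obtain ⟨v, hv, w, hw, rfl⟩ := Submodule.mem_sup.1
    (hcompl.sup_eq_top ▸ Submodule.mem_top : u ∈ K ⊔ R)
  have hTv : T v = v := by simpa [K, sub_eq_zero] using hv
  refine ⟨v, hTv, C * ‖w‖, r, by positivity, hr0, hr1, fun t => ?_⟩
  have hpv : (T ^ t) v = v := by
    induction t with
    | zero => simp
    | succ t ih => rw [pow_succ, Module.End.mul_apply, hTv, ih]
  have hpw : (T ^ t) w = (((T.restrict hmaps) ^ t) ⟨w, hw⟩ : R) := by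
    rw [Module.End.pow_restrict]; rfl
  rw [map_add, hpv, add_sub_cancel_left, hpw]
  refine (hbound ⟨w, hw⟩ t).trans (le_of_eq ?_)
  simp only [Submodule.coe_norm]
  ring

theorem exists_limit_of_pencil {V : Type*} [NormedAddCommGroup V]
    [NormedSpace ℂ V] [FiniteDimensional ℂ V] (P Q : V →ₗ[ℂ] V) (hP : ∀ u, P u = 0 → u = 0)
    (hμ : ∀ (μ : ℂ) u, u ≠ 0 → Q u = μ • P u → μ = 1 ∨ ‖μ‖ < 1)
    (h1 : ∀ u v, Q v = P v → Q u = P u + P v → v = 0)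
    (u : ℕ → V) (hu : ∀ t, P (u (t + 1)) = Q (u t)) :
    ∃ v, Q v = P v ∧ ∃ C r : ℝ, 0 ≤ C ∧ 0 ≤ r ∧ r < 1 ∧ ∀ t, ‖u t - v‖ ≤ C * r ^ t := by
  let e : V ≃ₗ[ℂ] V := LinearEquiv.ofInjectiveEndo P ((injective_iff_map_eq_zero P).2 hP)
  have he : ∀ v, e v = P v := fun v => rfl
  let T : Module.End ℂ V := e.symm.toLinearMap ∘ₗ Q
  have hT : ∀ v w, T v = w ↔ Q v = P w := fun v w => by
    rw [← he]; exact e.symm_apply_eq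
  obtain ⟨v, hv, C, r, hC, hr0, hr1, h⟩ := Module.End.exists_norm_pow_apply_sub_le T
    (fun μ hμT => by
      obtain ⟨v, hv⟩ := hμT.exists_hasEigenvector
      exact hμ μ v hv.2 (by simpa using (hT _ _).1 hv.apply_eq_smul))
    (fun u v hv huv => h1 u v ((hT _ _).1 hv) (by simpa using (hT _ _).1 huv)) (u 0)
  refine ⟨v, (hT _ _).1 hv, C, r, hC, hr0, hr1, fun t => ?_⟩
  have : u t = (T ^ t) (u 0) := by
    induction t with
    | zero => simp
    | succ t ih => rw [pow_succ', Module.End.mul_apply, ← ih, eq_comm, hT, hu]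
  rw [this]
  exact h t

section
variable {E : Type*} [NormedAddCommGroup E] [InnerProductSpace ℂ E]

theorem LinearMap.IsSymmetric.norm_map_lt {W : E →ₗ[ℂ] E} (hW : W.IsSymmetric)
    (hle : ∀ v, (⟪v, W v⟫_ℂ).re ≤ ‖v‖ ^ 2)
    (hgt : ∀ v, v ≠ 0 → -‖v‖ ^ 2 < (⟪v, W v⟫_ℂ).re) {v : E} (hv : W v ≠ v) : ‖W v‖ < ‖v‖ := by
  have hp := hgt (v - W v) (sub_ne_zero.2 hv.symm)
  have hq := hle (v + W v)
  have hs : (⟪v, W v⟫_ℂ).re = (⟪W v, v⟫_ℂ).re := by rw [hW]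
  have hs2 : (⟪W v, W (W v)⟫_ℂ).re = (⟪W (W v), W v⟫_ℂ).re := by rw [hW (W v)]
  have hs3 : ⟪v, W (W v)⟫_ℂ = ⟪W v, W v⟫_ℂ := (hW _ _).symm
  have n1 : ∀ u : E, ‖u‖ ^ 2 = (⟪u, u⟫_ℂ).re := fun u => (inner_self_eq_norm_sq (𝕜 := ℂ) u).symm
  rw [n1] at hp hq
  simp only [map_sub, map_add, inner_add_left, inner_add_right, inner_sub_left, inner_sub_right,
    Complex.add_re, Complex.sub_re, hs3] at hp hq
  have : ‖W v‖ ^ 2 < ‖v‖ ^ 2 := by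
    rw [n1, n1]
    linarith
  exact lt_of_pow_lt_pow_left₀ 2 (norm_nonneg _) this

end

section
variable {E F : Type*} [NormedAddCommGroup E] [InnerProductSpace ℂ E] [FiniteDimensional ℂ E]
  [NormedAddCommGroup F] [InnerProductSpace ℂ F] [FiniteDimensional ℂ F]

theorem exists_stationary_point (W : E →ₗ[ℂ] E) (B : E →ₗ[ℂ] F) (b : F) (hW : W.IsSymmetric) :
    ∃ e f : E, W e = e ∧ B.adjoint (B e - b) + (f - W f) = 0 := by
  let K := LinearMap.ker (LinearMap.id - W)
  let Ψ : K × E →ₗ[ℂ] E :=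
    ((B.adjoint ∘ₗ B) ∘ₗ K.subtype).coprod (LinearMap.id - W)
  have hmem : B.adjoint b ∈ LinearMap.range Ψ := by
    rw [← Submodule.orthogonal_orthogonal (LinearMap.range Ψ), Submodule.mem_orthogonal]
    intro y hy
    rw [Submodule.mem_orthogonal] at hy
    have hWy : W y = y := by
      have h := hy _ ⟨(0, y - W y), rfl⟩
      have hs : (LinearMap.id - W : E →ₗ[ℂ] E).IsSymmetric := LinearMap.IsSymmetric.id.sub hW
      have h' : ⟪y - W y, y - W y⟫_ℂ = 0 := by
        have := hs (y - W y) y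
        simp only [Ψ, LinearMap.coprod_apply, map_zero, zero_add] at h
        rw [this] at h
        simpa using h
      exact (sub_eq_zero.1 (inner_self_eq_zero.1 h')).symm
    have hBy : B y = 0 := by
      have h := hy _ ⟨(⟨y, by simp [K, hWy]⟩, 0), rfl⟩
      simpa [Ψ, LinearMap.adjoint_inner_left] using h
    rw [LinearMap.adjoint_inner_right, hBy, inner_zero_left]
  obtain ⟨⟨⟨e, he⟩, f⟩, h⟩ := hmem
  refine ⟨e, f, (sub_eq_zero.1 (by simpa [K] using he)).symm, ?_⟩
  have h' : B.adjoint (B e) + (f - W f) = B.adjoint b := by simpa [Ψ] using h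
  rw [map_sub, ← h']
  abel

theorem exists_limit_of_implicit_iteration (W : E →ₗ[ℂ] E) (B : E →ₗ[ℂ] F) (b : F) {c : ℝ}
    (hc : 0 ≤ c) (hW : W.IsSymmetric) (hle : ∀ v, (⟪v, W v⟫_ℂ).re ≤ ‖v‖ ^ 2)
    (hgt : ∀ v, v ≠ 0 → -‖v‖ ^ 2 < (⟪v, W v⟫_ℂ).re) (x z : ℕ → E)
    (hx : ∀ t, x (t + 1) = x t - B.adjoint (B (x (t + 1)) - b) - (z (t + 1) - W (z t))
      - (c : ℂ) • (x (t + 1) - W (x t)))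
    (hz : ∀ t, z (t + 1) = z t + (x (t + 1) - W (x t))) :
    ∃ e f : E, W e = e ∧ B.adjoint (B e - b) + (f - W f) = 0 ∧
      ∃ C r : ℝ, 0 ≤ C ∧ 0 ≤ r ∧ r < 1 ∧ ∀ t, ‖x t - e‖ ≤ C * r ^ t := by
  obtain ⟨e₀, f₀, he₀, hf₀⟩ := exists_stationary_point W B b hW
  let G : E →ₗ[ℂ] E := B.adjoint ∘ₗ B
  have hG : ∀ u v, ⟪u, G v⟫_ℂ = ⟪B u, B v⟫_ℂ := fun u v => LinearMap.adjoint_inner_right B _ _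
  let p := LinearMap.fst ℂ E E
  let q := LinearMap.snd ℂ E E
  let P : E × E →ₗ[ℂ] E × E := ((1 + (c : ℂ)) • p + G ∘ₗ p + q).prod (q - p)
  let Q : E × E →ₗ[ℂ] E × E := (p + W ∘ₗ q + (c : ℂ) • W ∘ₗ p).prod (q - W ∘ₗ p)
  have hPQ : ∀ (μ : ℂ) (u v : E × E), Q u = μ • P v ↔
      u.1 + W u.2 + (c : ℂ) • W u.1 = μ • ((1 + (c : ℂ)) • v.1 + G v.1 + v.2) ∧
      u.2 - W u.1 = μ • (v.2 - v.1) := fun μ u v => Prod.ext_iff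
  have hP : ∀ u, P u = 0 → u = 0 := by
    rintro ⟨e, f⟩ hef
    obtain ⟨h1, h2⟩ := Prod.ext_iff.1 hef
    have h1 : (1 + (c : ℂ)) • e + G e + f = 0 := h1
    have h2 : f - e = 0 := h2
    obtain rfl := sub_eq_zero.1 h2
    have h3 : (1 + c) * ‖f‖ ^ 2 + ‖B f‖ ^ 2 + ‖f‖ ^ 2 = 0 := by
      have h4 := congrArg (fun v => ⟪f, v⟫_ℂ) h1
      simp only [inner_add_right, inner_smul_right, hG, inner_self_eq_norm_sq_to_K,
        inner_zero_right] at h4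
      apply Complex.ofReal_injective
      push_cast
      exact h4
    have : ‖f‖ ^ 2 = 0 := by nlinarith [sq_nonneg ‖B f‖, sq_nonneg ‖f‖]
    have : f = 0 := by simpa using this
    simp [this]
  have hμ : ∀ (μ : ℂ) u, u ≠ 0 → Q u = μ • P u → μ = 1 ∨ ‖μ‖ < 1 := by
    rintro μ ⟨e, f⟩ hne hef
    rw [or_iff_not_imp_left]
    intro hμ
    obtain ⟨h1, h2⟩ := (hPQ _ _ _).1 hef
    simp only at h1 h2
    have hμ' : μ - 1 ≠ 0 := sub_ne_zero.2 hμ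
    have h2' : (μ - 1) • f = μ • e - W e := by
      linear_combination (norm := module) -h2
    have he : e ≠ 0 := by
      rintro rfl
      have : f = 0 := by simpa [hμ'] using h2'
      exact hne (by simp [this])
    have h2W : (μ - 1) • W f = μ • W e - W (W e) := by
      rw [← map_smul, h2', map_sub, map_smul]
    have h3 : (μ - 1) • (e + (c : ℂ) • W e) + (μ • W e - W (W e))
        = μ • ((μ - 1) • ((1 + (c : ℂ)) • e + G e) + (μ • e - W e)) := by
      rw [← h2', ← h2W]
      linear_combination (norm := module) (μ - 1) • h1
    have h4 := congrArg (fun v => ⟪e, v⟫_ℂ) h3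
    have hw : ⟪e, W e⟫_ℂ = ((⟪e, W e⟫_ℂ).re : ℂ) := by
      rw [eq_comm, ← Complex.conj_eq_iff_re, inner_conj_symm, hW]
    simp only [inner_add_right, inner_sub_right, inner_smul_right, hG, ← hW e (W e)] at h4
    rw [hw] at h4
    simp only [inner_self_eq_norm_sq_to_K] at h4
    have hn : 0 < ‖e‖ ^ 2 := by positivity
    have hle' := hle e
    have hgt' := hgt e he
    set w := (⟪e, W e⟫_ℂ).re
    have h5 : ((((2 + c) * ‖e‖ ^ 2 + ‖B e‖ ^ 2 : ℝ)) : ℂ) * μ ^ 2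
        - (((2 + c) * ‖e‖ ^ 2 + ‖B e‖ ^ 2 + (2 + c) * w : ℝ) : ℂ) * μ
        + ((‖e‖ ^ 2 + c * w + ‖W e‖ ^ 2 : ℝ) : ℂ) = 0 := by
      push_cast
      linear_combination -h4
    by_cases hWe : W e = e
    · have hwe : w = ‖e‖ ^ 2 := by
        simp only [w, hWe]
        exact inner_self_eq_norm_sq (𝕜 := ℂ) e
      rw [hWe, hwe] at h5
      have h6 : (((2 + c) * ‖e‖ ^ 2 + ‖B e‖ ^ 2 : ℝ) : ℂ) * μ = (((2 + c) * ‖e‖ ^ 2 : ℝ) : ℂ) := by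
        apply mul_left_cancel₀ hμ'
        push_cast at h5 ⊢
        linear_combination h5
      have hpos : 0 < (2 + c) * ‖e‖ ^ 2 := by positivity
      have hB : 0 < ‖B e‖ ^ 2 := by
        refine lt_of_le_of_ne (sq_nonneg _) fun h0 => hμ ?_
        rw [← h0, add_zero] at h6
        exact mul_left_cancel₀ (Complex.ofReal_ne_zero.2 hpos.ne') (h6.trans (mul_one _).symm)
      have h7 := congrArg norm h6
      rw [norm_mul, Complex.norm_of_nonneg (by positivity),
        Complex.norm_of_nonneg (by positivity)] at h7
      by_contra! h8
      nlinarith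
    · have hlt := hW.norm_map_lt hle hgt hWe
      have hlt2 : ‖W e‖ ^ 2 < ‖e‖ ^ 2 := by gcongr
      have hsub : 0 < ‖e‖ ^ 2 - 2 * w + ‖W e‖ ^ 2 := by
        have := norm_sub_sq (𝕜 := ℂ) e (W e)
        have h0 : 0 < ‖e - W e‖ ^ 2 := by
          have := norm_pos_iff.2 (sub_ne_zero.2 (Ne.symm hWe))
          positivity
        change _ = _ - 2 * w + _ at this
        linarith
      have hcw : c * w ≤ c * ‖e‖ ^ 2 := by gcongr
      have hcw' : -(c * ‖e‖ ^ 2) ≤ c * w := by nlinarith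
      have := sq_nonneg ‖B e‖
      have := sq_nonneg ‖W e‖
      refine norm_lt_one_of_real_quadratic (abs_lt.2 ⟨?_, ?_⟩) ?_ ?_ h5 <;> nlinarith
  have hss : ∀ u v, Q v = P v → Q u = P u + P v → v = 0 := by
    rintro ⟨e, f⟩ ⟨p', q'⟩ hv hu
    obtain ⟨h1, h2⟩ := (hPQ 1 _ _).1 (by rw [one_smul]; exact hv)
    obtain ⟨h3, h4⟩ := (hPQ 1 _ (e + p', f + q')).1 (by
      rw [one_smul, hu, ← map_add, Prod.mk_add_mk])
    simp only [one_smul] at h1 h2 h3 h4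
    have hWp : W p' = p' := sub_right_injective h2
    have h5 : G p' + (q' - W q') = 0 := by
      rw [hWp] at h1
      linear_combination (norm := module) -h1
    have hBp : B p' = 0 := by
      have h6 := congrArg (fun v => ⟪p', v⟫_ℂ) h5
      simp only [inner_add_right, inner_sub_right, hG, ← hW p' q', hWp, sub_self, add_zero,
        inner_zero_right] at h6
      exact inner_self_eq_zero.1 h6
    have hWq : W q' = q' := by
      have : G p' = 0 := by simp [G, hBp]
      rw [this, zero_add] at h5
      exact (sub_eq_zero.1 h5).symm
    have h7 : q' - p' = e - W e := by
      linear_combination (norm := module) -h4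
    have hqp : q' - p' = 0 := by
      have : ⟪q' - p', q' - p'⟫_ℂ = 0 := by
        nth_rewrite 2 [h7]
        rw [inner_sub_right, ← hW, map_sub, hWp, hWq, sub_self]
      exact inner_self_eq_zero.1 this
    have hWe : W e = e := (sub_eq_zero.1 (h7.symm.trans hqp)).symm
    obtain rfl := sub_eq_zero.1 hqp
    have h8 : (2 + (c : ℂ)) • q' + G e + (f - W f) = 0 := by
      have : G (e + q') = G e := by simp [G, hBp]
      rw [this, hWe] at h3
      linear_combination (norm := module) -h3
    have h9 := congrArg (fun v => ⟪q', v⟫_ℂ) h8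
    simp only [inner_add_right, inner_sub_right, inner_smul_right, hG, ← hW q' f, hWp, hBp,
      sub_self, add_zero, inner_zero_left, inner_zero_right] at h9
    have hc2 : (2 + (c : ℂ)) ≠ 0 := by
      norm_cast
      positivity
    have : q' = 0 := inner_self_eq_zero.1 ((mul_eq_zero.1 h9).resolve_left hc2)
    simp [this]
  have hrec : ∀ t, P (x (t + 1) - e₀, z (t + 1) - f₀) = Q (x t - e₀, z t - f₀) := by
    intro t
    rw [eq_comm, ← one_smul ℂ (P _), hPQ]
    have h1 := hx t
    have h2 := hz t
    have h3 : G (x (t + 1) - e₀) = B.adjoint (B (x (t + 1)) - b) - B.adjoint (B e₀ - b) := by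
      simp only [map_sub, G, LinearMap.comp_apply]; abel
    simp only [one_smul, map_sub W, he₀, h3]
    constructor
    · linear_combination (norm := module) hf₀ - h1
    · linear_combination (norm := module) -h2
  obtain ⟨⟨e, f⟩, hef, C, r, hC, hr0, hr1, h⟩ :=
    exists_limit_of_pencil P Q hP hμ hss (fun t => (x t - e₀, z t - f₀)) hrec
  obtain ⟨h1, h2⟩ := (hPQ 1 _ _).1 (by rw [one_smul]; exact hef)
  simp only [one_smul] at h1 h2
  have hWe : W e = e := sub_right_injective h2
  refine ⟨e₀ + e, f₀ + f, by rw [map_add, he₀, hWe], ?_, C, r, hC, hr0, hr1, fun t => ?_⟩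
  · have h3 : G e + (f - W f) = 0 := by
      rw [hWe] at h1
      linear_combination (norm := module) -h1
    have h4 : B.adjoint (B (e₀ + e) - b) = B.adjoint (B e₀ - b) + G e := by
      simp only [map_add, map_sub, G, LinearMap.comp_apply]; abel
    rw [h4, map_add]
    linear_combination (norm := module) hf₀ + h3
  · have := (norm_fst_le _).trans (h t)
    simpa [sub_sub] using this
end

section
variable {ι ι' : Type*} [Fintype ι]

theorem Matrix.re_toEuclideanLin_map_ofReal [DecidableEq ι] (M : Matrix ι' ι ℝ)
    (v : EuclideanSpace ℂ ι) :
    (fun i => (toEuclideanLin (M.map Complex.ofReal) v i).re) = M *ᵥ fun j => (v j).re := by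
  ext i
  simp [mulVec, dotProduct]

theorem Matrix.im_toEuclideanLin_map_ofReal [DecidableEq ι] (M : Matrix ι' ι ℝ)
    (v : EuclideanSpace ℂ ι) :
    (fun i => (toEuclideanLin (M.map Complex.ofReal) v i).im) = M *ᵥ fun j => (v j).im := by
  ext i
  simp [mulVec, dotProduct]

theorem Matrix.toEuclideanLin_map_ofReal_toLp [DecidableEq ι] (M : Matrix ι' ι ℝ) (v : ι → ℝ) :
    toEuclideanLin (M.map Complex.ofReal) (WithLp.toLp 2 fun j => (v j : ℂ))
      = WithLp.toLp 2 fun i => ((M *ᵥ v) i : ℂ) := by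
  ext i
  simp [mulVec, dotProduct]

theorem EuclideanSpace.re_inner_eq (u v : EuclideanSpace ℂ ι) :
    (⟪u, v⟫_ℂ).re = (fun i => (u i).re) ⬝ᵥ (fun i => (v i).re)
      + (fun i => (u i).im) ⬝ᵥ (fun i => (v i).im) := by
  simp only [PiLp.inner_apply, RCLike.inner_apply, Complex.re_sum, dotProduct,
    ← Finset.sum_add_distrib]
  refine Finset.sum_congr rfl fun i _ => ?_
  simp
  ring

theorem exists_real_limit_of_implicit_iteration [DecidableEq ι] [Fintype ι']
    [DecidableEq ι'] (W : Matrix ι ι ℝ) (B : Matrix ι' ι ℝ)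
    (b : ι' → ℝ) {c : ℝ} (hc : 0 ≤ c) (hW : W.IsSymm)
    (hle : ∀ v, v ⬝ᵥ (W *ᵥ v) ≤ v ⬝ᵥ v) (hgt : ∀ v, v ≠ 0 → -(v ⬝ᵥ v) < v ⬝ᵥ (W *ᵥ v))
    (x z : ℕ → ι → ℝ)
    (hx : ∀ t, x (t + 1) = x t - Bᵀ *ᵥ (B *ᵥ x (t + 1) - b) - (z (t + 1) - W *ᵥ z t)
      - c • (x (t + 1) - W *ᵥ x t))
    (hz : ∀ t, z (t + 1) = z t + (x (t + 1) - W *ᵥ x t)) :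
    ∃ e f : ι → ℝ, W *ᵥ e = e ∧ Bᵀ *ᵥ (B *ᵥ e - b) + (f - W *ᵥ f) = 0 ∧
      ∃ C r : ℝ, 0 ≤ C ∧ 0 ≤ r ∧ r < 1 ∧ ∀ t, ‖x t - e‖ ≤ C * r ^ t := by
  have hB : (toEuclideanLin (B.map Complex.ofReal)).adjoint
      = toEuclideanLin (Bᵀ.map Complex.ofReal) := by
    rw [← toEuclideanLin_conjTranspose_eq_adjoint]
    congr 1
    ext i j
    simp
  have hn : ∀ v : EuclideanSpace ℂ ι, ‖v‖ ^ 2 = (⟪v, v⟫_ℂ).re := fun v =>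
    (inner_self_eq_norm_sq (𝕜 := ℂ) v).symm
  have hgt' : ∀ v, -(v ⬝ᵥ v) ≤ v ⬝ᵥ (W *ᵥ v) := fun v => by
    rcases eq_or_ne v 0 with rfl | hv
    · simp
    · exact (hgt v hv).le
  let Wc := toEuclideanLin (W.map Complex.ofReal)
  let Bc := toEuclideanLin (B.map Complex.ofReal)
  let castE (v : ι → ℝ) : EuclideanSpace ℂ ι := WithLp.toLp 2 fun j => (v j : ℂ)
  let castF (v : ι' → ℝ) : EuclideanSpace ℂ ι' := WithLp.toLp 2 fun j => (v j : ℂ)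
  have hcast_sub : ∀ u v : ι' → ℝ, castF u - castF v = castF (u - v) := fun u v => by
    ext i
    simp [castF]
  have hWc : Wc.IsSymmetric := by
    rw [isSymmetric_toEuclideanLin_iff]
    ext i j
    simp [hW.apply]
  have hWle : ∀ v, (⟪v, Wc v⟫_ℂ).re ≤ ‖v‖ ^ 2 := fun v => by
    rw [hn, EuclideanSpace.re_inner_eq, EuclideanSpace.re_inner_eq, re_toEuclideanLin_map_ofReal,
      im_toEuclideanLin_map_ofReal]
    exact add_le_add (hle _) (hle _)
  have hWgt : ∀ v, v ≠ 0 → -‖v‖ ^ 2 < (⟪v, Wc v⟫_ℂ).re := fun v hv => by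
    rw [hn, EuclideanSpace.re_inner_eq, EuclideanSpace.re_inner_eq, re_toEuclideanLin_map_ofReal,
      im_toEuclideanLin_map_ofReal, neg_add]
    by_cases hre : (fun i => (v i).re) = 0
    · refine add_lt_add_of_le_of_lt (hgt' _) (hgt _ fun him => hv ?_)
      ext i
      exact Complex.ext (congrFun hre i) (congrFun him i)
    · exact add_lt_add_of_lt_of_le (hgt _ hre) (hgt' _)
  have hxc : ∀ t, castE (x (t + 1)) = castE (x t) - Bc.adjoint (Bc (castE (x (t + 1))) - castF b)
      - (castE (z (t + 1)) - Wc (castE (z t)))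
      - (c : ℂ) • (castE (x (t + 1)) - Wc (castE (x t))) := fun t => by
    have h : Bc (castE (x (t + 1))) - castF b = castF (B *ᵥ x (t + 1) - b) := by
      rw [← hcast_sub]
      exact congrArg (· - castF b) (toEuclideanLin_map_ofReal_toLp B _)
    rw [h, hB]
    simp only [Wc, castE, castF, toEuclideanLin_map_ofReal_toLp]
    ext i
    simpa using congrArg Complex.ofReal (congrFun (hx t) i)
  have hzc : ∀ t, castE (z (t + 1)) = castE (z t) + (castE (x (t + 1)) - Wc (castE (x t))) :=
    fun t => by
      simp only [Wc, castE, toEuclideanLin_map_ofReal_toLp]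
      ext i
      simpa using congrArg Complex.ofReal (congrFun (hz t) i)
  obtain ⟨e, f, he, hf, C, r, hC, hr0, hr1, h⟩ := exists_limit_of_implicit_iteration
    Wc Bc (castF b) hc hWc hWle hWgt (fun t => castE (x t)) (fun t => castE (z t)) hxc hzc
  refine ⟨fun i => (e i).re, fun i => (f i).re, ?_, ?_, C, r, hC, hr0, hr1, fun t => ?_⟩
  · rw [← re_toEuclideanLin_map_ofReal]
    exact congrArg (fun (v : EuclideanSpace ℂ ι) (i : ι) => (v i).re) he
  · have h1 : (B *ᵥ fun i => (e i).re) - b = fun j => ((Bc e - castF b) j).re := by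
      rw [← re_toEuclideanLin_map_ofReal]
      ext j
      simp [Bc, castF]
    rw [h1, ← re_toEuclideanLin_map_ofReal, ← re_toEuclideanLin_map_ofReal, ← hB]
    exact congrArg (fun (v : EuclideanSpace ℂ ι) (i : ι) => (v i).re) hf
  · refine (pi_norm_le_iff_of_nonneg (by positivity)).2 fun i => ?_
    refine le_trans ?_ ((PiLp.norm_apply_le _ i).trans (h t))
    simpa using Complex.abs_re_le_norm ((x t i : ℂ) - e i)
end

theorem Matrix.IsSymm.two_mul_sum_rowSum_add {m : Type*} [Fintype m] {W : Matrix m m ℝ}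
    (hW : W.IsSymm) (ε : ℝ) (hε : ε ^ 2 = 1) (y : m → ℝ) :
    2 * (∑ i, (∑ j, W i j) * y i ^ 2 + ε * ∑ i, ∑ j, W i j * y i * y j)
      = ∑ i, ∑ j, W i j * (y i + ε * y j) ^ 2 := by
  have h : ∑ i, ∑ j, W i j * y j ^ 2 = ∑ i, ∑ j, W i j * y i ^ 2 := by
    rw [Finset.sum_comm]
    simp only [hW.apply]
  have h' : ∑ i, ∑ j, W i j * (y i + ε * y j) ^ 2 = ∑ i, ∑ j, W i j * y i ^ 2
      + 2 * ε * ∑ i, ∑ j, W i j * y i * y j + ∑ i, ∑ j, W i j * y j ^ 2 := by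
    simp only [Finset.mul_sum, ← Finset.sum_add_distrib]
    refine Finset.sum_congr rfl fun i _ => Finset.sum_congr rfl fun j _ => ?_
    linear_combination W i j * y j ^ 2 * hε
  rw [h', h]
  simp only [Finset.sum_mul]
  ring

theorem bar_mulVec_apply {m n : ℕ} (M : Matrix (Fin m) (Fin m) ℝ) (v : Fin m × Fin n → ℝ)
    (p : Fin m × Fin n) : (bar n M *ᵥ v) p = ∑ j, M p.1 j * v (j, p.2) := by
  simp [bar, mulVec, dotProduct, Fintype.sum_prod_type, Matrix.one_apply]

theorem bar_diagonal_mulVec_apply {m n : ℕ} (d : Fin m → ℝ) (v : Fin m × Fin n → ℝ)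
    (p : Fin m × Fin n) : (bar n (diagonal d) *ᵥ v) p = d p.1 * v p := by
  simp [bar_mulVec_apply, diagonal_apply]

theorem blockDiag_mulVec_const {m n : ℕ} (ni : Fin m → ℕ)
    (A : ∀ i, Matrix (Fin (ni i)) (Fin n) ℝ) (y : Fin n → ℝ) :
    blockDiag ni A *ᵥ (fun p => y p.2) = fun q => (A q.1 *ᵥ y) q.2 := by
  ext q
  simp [_root_.blockDiag, mulVec, dotProduct, Fintype.sum_prod_type]

theorem dotProduct_bar_mulVec {m n : ℕ} (W : Matrix (Fin m) (Fin m) ℝ) (y : Fin m × Fin n → ℝ) :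
    y ⬝ᵥ (bar n W *ᵥ y) = ∑ k, ∑ i, ∑ j, W i j * y (i, k) * y (j, k) := by
  simp only [dotProduct, bar_mulVec_apply, Fintype.sum_prod_type, Finset.mul_sum]
  rw [Finset.sum_comm]
  refine Finset.sum_congr rfl fun k _ => Finset.sum_congr rfl fun i _ =>
    Finset.sum_congr rfl fun j _ => by ring

theorem dotProduct_bar_mulVec_le {m n : ℕ} {W : Matrix (Fin m) (Fin m) ℝ} (hW : W.IsSymm)
    (hnn : ∀ i j, 0 ≤ W i j) (y : Fin m × Fin n → ℝ) :
    y ⬝ᵥ (bar n W *ᵥ y) ≤ ∑ p : Fin m × Fin n, (∑ j, W p.1 j) * y p ^ 2 := by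
  rw [dotProduct_bar_mulVec, Fintype.sum_prod_type_right]
  refine Finset.sum_le_sum fun k _ => ?_
  have h := hW.two_mul_sum_rowSum_add (-1) (by norm_num) fun i => y (i, k)
  have h' : 0 ≤ ∑ i, ∑ j, W i j * (y (i, k) + -1 * y (j, k)) ^ 2 :=
    Finset.sum_nonneg fun i _ => Finset.sum_nonneg fun j _ => mul_nonneg (hnn i j) (sq_nonneg _)
  linarith

theorem neg_lt_dotProduct_bar_mulVec {m n : ℕ} {W : Matrix (Fin m) (Fin m) ℝ} (hW : W.IsSymm)
    (hnn : ∀ i j, 0 ≤ W i j) (hdiag : ∀ i, 0 < W i i) {y : Fin m × Fin n → ℝ} (hy : y ≠ 0) :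
    -∑ p : Fin m × Fin n, (∑ j, W p.1 j) * y p ^ 2 < y ⬝ᵥ (bar n W *ᵥ y) := by
  obtain ⟨p, hp⟩ := Function.ne_iff.1 hy
  have hpos : 0 < ∑ k, ∑ i, 2 * (W i i * y (i, k) ^ 2) := by
    rw [← Fintype.sum_prod_type_right (f := fun p : Fin m × Fin n => 2 * (W p.1 p.1 * y p ^ 2))]
    have hp' : y p ≠ 0 := hp
    have := hdiag p.1
    exact Finset.sum_pos' (fun q _ => by have := hdiag q.1; positivity)
      ⟨p, Finset.mem_univ _, by positivity⟩
  have hle : ∑ k, ∑ i, 2 * (W i i * y (i, k) ^ 2) ≤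
      ∑ k, (∑ i, (∑ j, W i j) * y (i, k) ^ 2 + ∑ i, ∑ j, W i j * y (i, k) * y (j, k)) := by
    refine Finset.sum_le_sum fun k _ => ?_
    have h := hW.two_mul_sum_rowSum_add 1 (by norm_num) fun i => y (i, k)
    have h' : ∑ i, 4 * (W i i * y (i, k) ^ 2)
        ≤ ∑ i, ∑ j, W i j * (y (i, k) + 1 * y (j, k)) ^ 2 := by
      refine Finset.sum_le_sum fun i _ => ?_
      refine le_trans (le_of_eq ?_) (Finset.single_le_sum
        (f := fun j => W i j * (y (i, k) + 1 * y (j, k)) ^ 2)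
        (fun j _ => mul_nonneg (hnn i j) (sq_nonneg _)) (Finset.mem_univ i))
      ring
    rw [← Finset.mul_sum] at h' ⊢
    linarith
  rw [Finset.sum_add_distrib] at hle
  rw [dotProduct_bar_mulVec, Fintype.sum_prod_type_right]
  linarith

theorem sum_residual_le_of_orthogonal {m n : ℕ} {ni : Fin m → ℕ}
    (A : ∀ i, Matrix (Fin (ni i)) (Fin n) ℝ) (b : ∀ i, Fin (ni i) → ℝ) {u : Fin n → ℝ}
    (h : ∀ v, ∑ i, (A i *ᵥ v) ⬝ᵥ (A i *ᵥ u - b i) = 0) (y : Fin n → ℝ) :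
    ∑ i, (A i *ᵥ u - b i) ⬝ᵥ (A i *ᵥ u - b i) ≤ ∑ i, (A i *ᵥ y - b i) ⬝ᵥ (A i *ᵥ y - b i) := by
  have key : ∀ i, (A i *ᵥ y - b i) ⬝ᵥ (A i *ᵥ y - b i) = (A i *ᵥ u - b i) ⬝ᵥ (A i *ᵥ u - b i)
      + 2 * ((A i *ᵥ (y - u)) ⬝ᵥ (A i *ᵥ u - b i))
      + (A i *ᵥ (y - u)) ⬝ᵥ (A i *ᵥ (y - u)) := fun i => by
    have : A i *ᵥ y - b i = (A i *ᵥ u - b i) + A i *ᵥ (y - u) := by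
      rw [mulVec_sub]; abel
    rw [this, add_dotProduct, dotProduct_add, dotProduct_add,
      dotProduct_comm (A i *ᵥ u - b i) (A i *ᵥ (y - u))]
    ring
  simp only [key, Finset.sum_add_distrib, ← Finset.mul_sum, h]
  have : 0 ≤ ∑ i, (A i *ᵥ (y - u)) ⬝ᵥ (A i *ᵥ (y - u)) :=
    Finset.sum_nonneg fun i _ => Finset.sum_nonneg fun j _ => mul_self_nonneg _
  linarith

theorem stmt1 (m n : ℕ) (ni : Fin m → ℕ)
    (W : Matrix (Fin m) (Fin m) ℝ)
    (A : ∀ i, Matrix (Fin (ni i)) (Fin n) ℝ) (b : ∀ i, Fin (ni i) → ℝ)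
    (c cbar : ℝ) (κ : Fin m → ℝ)
    (hWsymm : W.IsSymm)
    (hWnn : ∀ i j, 0 ≤ W i j)
    (hWdiag : ∀ i, 0 < W i i)
    (hker : ∀ v : Fin m → ℝ,
      (rowSumDiag W - W).mulVec v = 0 ↔ ∃ a : ℝ, v = fun _ => a)
    (hc : 0 ≤ c) (hcbar : 0 < cbar)
    (hκ : ∀ i, κ i = (∑ j, W i j)⁻¹)
    (x z : ℕ → Fin m × Fin n → ℝ)
    (hx : ∀ t, x (t + 1) = x t
        - cbar • (bar n (Matrix.diagonal κ)).mulVec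
            (((blockDiag ni A)ᵀ * blockDiag ni A).mulVec (x (t + 1))
              - (blockDiag ni A)ᵀ.mulVec (bvec b))
        - (bar n (Matrix.diagonal κ)).mulVec
            ((bar n (rowSumDiag W)).mulVec (z (t + 1)) - (bar n W).mulVec (z t))
        - c • (bar n (Matrix.diagonal κ)).mulVec
            ((bar n (rowSumDiag W)).mulVec (x (t + 1)) - (bar n W).mulVec (x t)))
    (hz : ∀ t, z (t + 1) = z t + (bar n (Matrix.diagonal κ)).mulVec
        ((bar n (rowSumDiag W)).mulVec (x (t + 1)) - (bar n W).mulVec (x t))) :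
    ∃ xstar : Fin n → ℝ,
      (∀ y : Fin n → ℝ,
        (1 / 2) * ∑ i, (((A i).mulVec xstar - b i) ⬝ᵥ ((A i).mulVec xstar - b i)) ≤
        (1 / 2) * ∑ i, (((A i).mulVec y - b i) ⬝ᵥ ((A i).mulVec y - b i))) ∧
      ∃ C r : ℝ, 0 ≤ C ∧ 0 ≤ r ∧ r < 1 ∧
        ∀ t, ‖x t - (fun p : Fin m × Fin n => xstar p.2)‖ ≤ C * r ^ t := by
  let d : Fin m → ℝ := fun i => ∑ j, W i j
  have hdpos : ∀ i, 0 < d i := fun i =>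
    Finset.sum_pos' (fun j _ => hWnn i j) ⟨i, Finset.mem_univ _, hWdiag i⟩
  let s : Fin m × Fin n → ℝ := fun p => √(d p.1)
  let σ : Fin m × Fin n → ℝ := fun p => (s p)⁻¹
  have hs : ∀ p, s p ≠ 0 := fun p => (Real.sqrt_pos.2 (hdpos p.1)).ne'
  have hss : ∀ p, s p * s p = d p.1 := fun p => Real.mul_self_sqrt (hdpos p.1).le
  have hσs : ∀ p, σ p * s p = 1 := fun p => inv_mul_cancel₀ (hs p)
  have hσs' : ∀ v : Fin m × Fin n → ℝ, (σ * (s * v)) = v := fun v => by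
    ext p
    simp only [Pi.mul_apply]
    rw [← mul_assoc, hσs, one_mul]
  have hsκ : ∀ p, s p * κ p.1 = σ p := fun p => by
    rw [hκ, show ∑ j, W p.1 j = s p * s p from (hss p).symm, mul_inv, ← mul_assoc,
      mul_inv_cancel₀ (hs p), one_mul]
  have hσd : ∀ p, σ p * d p.1 = s p := fun p => by rw [← hss, ← mul_assoc, hσs, one_mul]
  have hdiagσ : ∀ v, diagonal σ *ᵥ v = σ * v := fun v => by
    ext p
    rw [mulVec_diagonal, Pi.mul_apply]
  let Wn : Matrix (Fin m × Fin n) (Fin m × Fin n) ℝ := diagonal σ * bar n W * diagonal σ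
  let Bn := √cbar • (_root_.blockDiag ni A * diagonal σ)
  have hWn : ∀ v, Wn *ᵥ v = σ * bar n W *ᵥ (σ * v) := fun v => by
    simp only [Wn, ← mulVec_mulVec, hdiagσ]
  have hBn : ∀ v, Bn *ᵥ v = √cbar • (_root_.blockDiag ni A *ᵥ (σ * v)) := fun v => by
    simp only [Bn, smul_mulVec, ← mulVec_mulVec, hdiagσ]
  have hBnT : ∀ v, Bnᵀ *ᵥ v = √cbar • (σ * (_root_.blockDiag ni A)ᵀ *ᵥ v) := fun v => by
    simp only [Bn, transpose_smul, transpose_mul, diagonal_transpose, smul_mulVec,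
      ← mulVec_mulVec, hdiagσ]
  have hgrad : ∀ v, Bnᵀ *ᵥ (Bn *ᵥ v - √cbar • bvec b) = cbar • (σ * ((_root_.blockDiag ni A)ᵀ *ᵥ
      (_root_.blockDiag ni A *ᵥ (σ * v) - bvec b))) := fun v => by
    rw [hBnT, hBn, ← smul_sub, mulVec_smul, mul_smul_comm, smul_smul,
      Real.mul_self_sqrt hcbar.le]
  have hbarsymm : (bar n W).IsSymm := by
    rw [Matrix.IsSymm, bar, ← kroneckerMap_transpose, hWsymm.eq, transpose_one]
  have hWnsymm : Wn.IsSymm := by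
    simp only [Matrix.IsSymm, Wn, transpose_mul, diagonal_transpose, hbarsymm.eq, Matrix.mul_assoc]
  have hquad : ∀ v, v ⬝ᵥ (Wn *ᵥ v) = (σ * v) ⬝ᵥ (bar n W *ᵥ (σ * v)) := fun v => by
    rw [hWn]
    exact Finset.sum_congr rfl fun p _ => by simp only [Pi.mul_apply]; ring
  have hnorm : ∀ v, v ⬝ᵥ v = ∑ p : Fin m × Fin n, (∑ j, W p.1 j) * (σ p * v p) ^ 2 := fun v =>
    Finset.sum_congr rfl fun p _ => by
      change _ = d p.1 * (σ p * v p) ^ 2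
      rw [← hss]
      linear_combination -(v p * v p) * (σ p * s p + 1) * hσs p
  obtain ⟨e, f, he, hf, C, r, hC, hr0, hr1, h⟩ := exists_real_limit_of_implicit_iteration Wn Bn
    (√cbar • bvec b) hc hWnsymm
    (fun v => by
      rw [hquad, hnorm]
      exact dotProduct_bar_mulVec_le hWsymm hWnn _)
    (fun v hv => by
      rw [hquad, hnorm]
      refine neg_lt_dotProduct_bar_mulVec hWsymm hWnn hWdiag fun h0 => hv ?_
      ext p
      simpa [σ, hs] using congrFun h0 p)
    (fun t => s * x t) (fun t => s * z t)
    (fun t => by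
      rw [hgrad, hWn, hWn]
      simp only [hσs']
      ext p
      have hp := congrFun (hx t) p
      simp only [Pi.sub_apply, Pi.mul_apply, Pi.smul_apply, smul_eq_mul,
        bar_diagonal_mulVec_apply, rowSumDiag, ← mulVec_mulVec, ← mulVec_sub] at hp ⊢
      change x (t + 1) p = x t p
        - cbar * (κ p.1 * ((_root_.blockDiag ni A)ᵀ *ᵥ
          (_root_.blockDiag ni A *ᵥ x (t + 1) - bvec b)) p)
        - κ p.1 * (d p.1 * z (t + 1) p - (bar n W *ᵥ z t) p)
        - c * (κ p.1 * (d p.1 * x (t + 1) p - (bar n W *ᵥ x t) p)) at hp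
      linear_combination s p * hp
        - (cbar * ((_root_.blockDiag ni A)ᵀ *ᵥ
            (_root_.blockDiag ni A *ᵥ x (t + 1) - bvec b)) p
          + (d p.1 * z (t + 1) p - (bar n W *ᵥ z t) p)
          + c * (d p.1 * x (t + 1) p - (bar n W *ᵥ x t) p)) * hsκ p
        - (z (t + 1) p + c * x (t + 1) p) * hσd p)
    (fun t => by
      rw [hWn, hσs']
      ext p
      have hp := congrFun (hz t) p
      simp only [Pi.add_apply, Pi.sub_apply, Pi.mul_apply,
        bar_diagonal_mulVec_apply, rowSumDiag] at hp ⊢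
      change z (t + 1) p = z t p + κ p.1 * (d p.1 * x (t + 1) p - (bar n W *ᵥ x t) p) at hp
      linear_combination s p * hp
        + (d p.1 * x (t + 1) p - (bar n W *ᵥ x t) p) * hsκ p + x (t + 1) p * hσd p)
  have hX : ∀ p, (bar n W *ᵥ (σ * e)) p = d p.1 * (σ * e) p := fun p => by
    have hp : σ p * (bar n W *ᵥ (σ * e)) p = e p := by
      have := congrFun he p
      rwa [hWn] at this
    rw [Pi.mul_apply, ← hp, ← hss]
    linear_combination -(σ p * s p + 1) * (bar n W *ᵥ (σ * e)) p * hσs p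
  have hcons : ∀ k, ∃ a, ∀ i, (σ * e) (i, k) = a := fun k => by
    obtain ⟨a, ha⟩ := (hker fun i => (σ * e) (i, k)).1 (by
      ext i
      have := hX (i, k)
      rw [bar_mulVec_apply] at this
      rw [rowSumDiag, sub_mulVec, Pi.sub_apply, mulVec_diagonal, Pi.zero_apply, sub_eq_zero]
      exact this.symm)
    exact ⟨a, congrFun ha⟩
  choose u hu using hcons
  have hσe : σ * e = fun p => u p.2 := funext fun p => hu p.2 p.1
  refine ⟨u, fun y => ?_, ‖σ‖ * C, r, by positivity, hr0, hr1, fun t => ?_⟩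
  · refine mul_le_mul_of_nonneg_left (sum_residual_le_of_orthogonal A b (fun v => ?_) y)
      (by norm_num)
    let w : Fin m × Fin n → ℝ := fun p => v p.2
    have hWw : Wn *ᵥ (s * w) = s * w := by
      rw [hWn, hσs']
      ext p
      have hp : ∑ j, W p.1 j * w (j, p.2) = d p.1 * w p :=
        (Finset.sum_mul Finset.univ (W p.1) (v p.2)).symm
      rw [Pi.mul_apply, Pi.mul_apply, bar_mulVec_apply, hp, ← mul_assoc, hσd]
    have horth : (s * w) ⬝ᵥ (f - Wn *ᵥ f) = 0 := by
      rw [dotProduct_sub, dotProduct_mulVec, ← mulVec_transpose, hWnsymm.eq, hWw, sub_self]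
    have h0 := congrArg (fun g => (s * w) ⬝ᵥ g) hf
    simp only [dotProduct_add, horth, add_zero, hgrad, dotProduct_smul, dotProduct_zero,
      smul_eq_mul] at h0
    have h1 := (mul_eq_zero.1 h0).resolve_left hcbar.ne'
    have h2 : w ⬝ᵥ ((_root_.blockDiag ni A)ᵀ *ᵥ (_root_.blockDiag ni A *ᵥ (σ * e) - bvec b))
        = 0 := by
      rw [← h1]
      refine Finset.sum_congr rfl fun p _ => ?_
      simp only [Pi.mul_apply]
      linear_combination -(w p * ((_root_.blockDiag ni A)ᵀ *ᵥ
        (_root_.blockDiag ni A *ᵥ (σ * e) - bvec b)) p) * hσs p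
    rw [dotProduct_mulVec, vecMul_transpose, hσe, blockDiag_mulVec_const,
      blockDiag_mulVec_const] at h2
    rw [← h2, dotProduct, Fintype.sum_sigma]
    rfl
  · have hsub : (x t - fun p => u p.2) = σ * (s * x t - e) := by
      rw [mul_sub, hσs', hσe]
    rw [hsub, mul_assoc]
    exact (norm_mul_le _ _).trans (mul_le_mul_of_nonneg_left (h t) (norm_nonneg _))
end
end

section
/- Suppose W is an m×m real symmetric matrix with nonnegative entries and positive diagonal entries, κ_1,…,κ_m > 0, c ≥ 0, c̄ > 0, and E is invertible. Then −1 is not an eigenvalue of Q = E⁻¹ F. -/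
open Matrix
open scoped Kronecker

noncomputable section

/-- The block matrix `E`. -/
def Emat {m n : ℕ} (ni : Fin m → ℕ) (A : ∀ i, Matrix (Fin (ni i)) (Fin n) ℝ)
    (W : Matrix (Fin m) (Fin m) ℝ) (κ : Fin m → ℝ) (c cbar : ℝ) :
    Matrix ((Fin m × Fin n) ⊕ (Fin m × Fin n)) ((Fin m × Fin n) ⊕ (Fin m × Fin n)) ℝ :=
  Matrix.fromBlocks
    (1 + cbar • (bar n (Matrix.diagonal κ) * ((blockDiag ni A)ᵀ * blockDiag ni A))
       + c • (bar n (Matrix.diagonal κ) * bar n (rowSumDiag W)))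
    (bar n (Matrix.diagonal κ) * bar n (rowSumDiag W))
    (-(bar n (Matrix.diagonal κ) * bar n (rowSumDiag W)))
    1

/-- The block matrix `F`. -/
def Fmat (n : ℕ) {m : ℕ} (W : Matrix (Fin m) (Fin m) ℝ) (κ : Fin m → ℝ) (c : ℝ) :
    Matrix ((Fin m × Fin n) ⊕ (Fin m × Fin n)) ((Fin m × Fin n) ⊕ (Fin m × Fin n)) ℝ :=
  Matrix.fromBlocks
    (1 + c • (bar n (Matrix.diagonal κ) * bar n W))
    (bar n (Matrix.diagonal κ) * bar n W)
    (-(bar n (Matrix.diagonal κ) * bar n W))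
    1

/-- The quadratic form of the signless Laplacian `D + W` is nonnegative. -/
theorem posSemidef_rowSumDiag_add {m : ℕ} {W : Matrix (Fin m) (Fin m) ℝ}
    (hsymm : W.IsSymm) (hnn : ∀ i j, 0 ≤ W i j) : (rowSumDiag W + W).PosSemidef := by
  refine PosSemidef.of_dotProduct_mulVec_nonneg ?_ fun x => ?_
  · rw [IsHermitian, conjTranspose_eq_transpose_of_trivial, transpose_add, hsymm.eq,
      rowSumDiag, diagonal_transpose]
  · have hx : x ⬝ᵥ ((rowSumDiag W + W) *ᵥ x)
        = ∑ i, ∑ j, W i j * x i ^ 2 + ∑ i, ∑ j, W i j * (x i * x j) := by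
      rw [rowSumDiag, add_mulVec, dotProduct_add, dotProduct, dotProduct]
      congr 1 <;> refine Finset.sum_congr rfl fun i _ => ?_
      · rw [mulVec_diagonal, ← Finset.sum_mul]
        ring
      · rw [mulVec, dotProduct, Finset.mul_sum]
        exact Finset.sum_congr rfl fun j _ => by ring
    have hswap : ∑ i, ∑ j, W i j * x i ^ 2 = ∑ i, ∑ j, W i j * x j ^ 2 := by
      rw [Finset.sum_comm]
      exact Finset.sum_congr rfl fun i _ => Finset.sum_congr rfl fun j _ => by rw [hsymm.apply]
    have hsq : 0 ≤ ∑ i, ∑ j, W i j * (x i + x j) ^ 2 :=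
      Finset.sum_nonneg fun i _ => Finset.sum_nonneg fun j _ =>
        mul_nonneg (hnn i j) (sq_nonneg _)
    have hexp : ∑ i, ∑ j, W i j * (x i + x j) ^ 2
        = ∑ i, ∑ j, W i j * x i ^ 2 + 2 * ∑ i, ∑ j, W i j * (x i * x j)
          + ∑ i, ∑ j, W i j * x j ^ 2 := by
      simp only [Finset.mul_sum, ← Finset.sum_add_distrib]
      exact Finset.sum_congr rfl fun i _ => Finset.sum_congr rfl fun j _ => by ring
    rw [star_trivial, hx]
    linarith

theorem bar_diagonal (n : ℕ) {m : ℕ} (κ : Fin m → ℝ) :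
    bar n (diagonal κ) = diagonal fun p => κ p.1 := by
  rw [bar, ← diagonal_one, diagonal_kronecker_diagonal]
  simp

/-- A saddle-point system with positive semidefinite blocks, preconditioned by a positive
diagonal matrix, has only the trivial solution. -/
theorem eq_zero_of_saddle_point {ι : Type*} [Fintype ι] [DecidableEq ι] {k : ι → ℝ}
    (hk : ∀ i, 0 < k i) {P S : Matrix ι ι ℝ} (hP : P.PosSemidef) (hS : S.IsSymm)
    {x y : ι → ℝ} (hx : (2 : ℝ) • x + diagonal k *ᵥ (P *ᵥ x + S *ᵥ y) = 0)
    (hy : (2 : ℝ) • y = diagonal k *ᵥ (S *ᵥ x)) : x = 0 ∧ y = 0 := by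
  have hx0 : x = 0 := by
    have hSy : x ⬝ᵥ (S *ᵥ y) = ∑ i, 2 * y i ^ 2 / k i := by
      rw [dotProduct_mulVec, ← mulVec_transpose, hS.eq, dotProduct]
      refine Finset.sum_congr rfl fun i _ => ?_
      have h := congrFun hy i
      rw [mulVec_diagonal, Pi.smul_apply, smul_eq_mul] at h
      rw [eq_div_iff (hk i).ne']
      linear_combination (-y i) * h
    have hxx : x ⬝ᵥ (P *ᵥ x) + x ⬝ᵥ (S *ᵥ y) = -∑ i, 2 * x i ^ 2 / k i := by
      rw [← dotProduct_add, dotProduct, ← Finset.sum_neg_distrib]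
      refine Finset.sum_congr rfl fun i _ => ?_
      have h := congrFun hx i
      rw [Pi.add_apply, mulVec_diagonal, Pi.smul_apply, smul_eq_mul, Pi.zero_apply] at h
      rw [← neg_div, eq_div_iff (hk i).ne']
      linear_combination x i * h
    have hterm (z : ι → ℝ) (i : ι) : 0 ≤ 2 * z i ^ 2 / k i :=
      div_nonneg (by positivity) (hk i).le
    have hPx := hP.dotProduct_mulVec_nonneg x
    rw [star_trivial] at hPx
    have hynn := Finset.sum_nonneg fun i (_ : i ∈ Finset.univ) => hterm y i
    have hxnn := Finset.sum_nonneg fun i (_ : i ∈ Finset.univ) => hterm x i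
    have hsum : ∑ i, 2 * x i ^ 2 / k i = 0 := by linarith
    funext i
    have h := (Finset.sum_eq_zero_iff_of_nonneg fun i _ => hterm x i).mp hsum i (Finset.mem_univ i)
    simpa [(hk i).ne'] using h
  refine ⟨hx0, ?_⟩
  rw [hx0, mulVec_zero, mulVec_zero] at hy
  exact (smul_eq_zero.mp hy).resolve_left two_ne_zero

theorem stmt4 (m n : ℕ) (ni : Fin m → ℕ)
    (A : ∀ i, Matrix (Fin (ni i)) (Fin n) ℝ)
    (W : Matrix (Fin m) (Fin m) ℝ) (κ : Fin m → ℝ) (c cbar : ℝ)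
    (hWsymm : W.IsSymm) (hWnn : ∀ i j, 0 ≤ W i j) (hWdiag : ∀ i, 0 < W i i)
    (hκ : ∀ i, 0 < κ i) (hc : 0 ≤ c) (hcbar : 0 < cbar)
    (hE : IsUnit (Emat ni A W κ c cbar)) :
    ¬ ∃ v : ((Fin m × Fin n) ⊕ (Fin m × Fin n)) → ℝ, v ≠ 0 ∧
      ((Emat ni A W κ c cbar)⁻¹ * Fmat n W κ c).mulVec v = (-1 : ℝ) • v := by
  rintro ⟨v, hv, hQ⟩
  have hS : (bar n (rowSumDiag W) + bar n W).PosSemidef := by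
    rw [bar, bar, ← add_kronecker]
    exact (posSemidef_rowSumDiag_add hWsymm hWnn).kronecker PosSemidef.one
  have hEF : Emat ni A W κ c cbar *ᵥ v + Fmat n W κ c *ᵥ v = 0 := by
    have h := congrArg (Emat ni A W κ c cbar *ᵥ ·) hQ
    simp only [mulVec_mulVec, mulVec_smul] at h
    rw [mul_nonsing_inv_cancel_left _ _ ((isUnit_iff_isUnit_det _).mp hE)] at h
    rw [h]
    simp
  obtain ⟨x, y, rfl⟩ : ∃ x y, v = Sum.elim x y := ⟨_, _, (Sum.elim_comp_inl_inr v).symm⟩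
  rw [Emat, Fmat, fromBlocks_mulVec, fromBlocks_mulVec, Sum.elim_comp_inl, Sum.elim_comp_inr] at hEF
  have hG : ((blockDiag ni A)ᵀ * blockDiag ni A).PosSemidef := by
    simpa using posSemidef_conjTranspose_mul_self (blockDiag ni A)
  have hxy := eq_zero_of_saddle_point (k := fun p : Fin m × Fin n => κ p.1) (fun p => hκ p.1)
    ((hG.smul hcbar.le).add (hS.smul hc)) (by simpa using hS.isHermitian)
    (x := x) (y := y) ?_ ?_
  · exact hv (by rw [hxy.1, hxy.2]; exact Sum.elim_zero_zero)
  · rw [← bar_diagonal]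
    funext p
    have h := congrFun hEF (Sum.inl p)
    simp [add_mulVec, mulVec_add, smul_mulVec, mulVec_smul, ← mulVec_mulVec] at h ⊢
    linear_combination h
  · rw [← bar_diagonal]
    funext p
    have h := congrFun hEF (Sum.inr p)
    simp [add_mulVec, mulVec_add, neg_mulVec, ← mulVec_mulVec] at h ⊢
    linear_combination h
end
end
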